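/- Along any trajectory of the mechanical system with inner-loop control u(t) := τ(t) − ∇V_a(q_a(t)), the signal y_d(t) = k_a q̇_a(t) + (k_a − k_u) m_aa⁻¹ m_au(q_u(t)) q̇_u(t) satisfies ẏ_d(t) = (k_a − k_u) m_aa⁻¹ u(t) + k_u q̈_a(t) for all t ≥ 0. -/

import Mathlib

open Matrix Set Filter

noncomputable section

/-- Componentwise gradient of a scalar function on `Fin k → ℝ`. -/
def grad {k : ℕ} (f : (Fin k → ℝ) → ℝ) (x : Fin k → ℝ) : Fin k → ℝ :=
  fun i => fderiv ℝ f x (Pi.single i 1)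

/-- The block inertia matrix `M(q_u) = [[m_uu, m_auᵀ], [m_au, m_aa]]`. -/
def Mblk {s m : ℕ} (muu : (Fin s → ℝ) → Matrix (Fin s) (Fin s) ℝ)
    (mau : (Fin s → ℝ) → Matrix (Fin m) (Fin s) ℝ)
    (maa : Matrix (Fin m) (Fin m) ℝ) (qu : Fin s → ℝ) :
    Matrix (Fin s ⊕ Fin m) (Fin s ⊕ Fin m) ℝ :=
  Matrix.fromBlocks (muu qu) (mau qu)ᵀ (mau qu) maa

/-- The Jacobian `J(q, v)` (w.r.t. `q`) of the map `q ↦ M(q_u) v`. -/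
def Jmat {s m : ℕ} (muu : (Fin s → ℝ) → Matrix (Fin s) (Fin s) ℝ)
    (mau : (Fin s → ℝ) → Matrix (Fin m) (Fin s) ℝ)
    (maa : Matrix (Fin m) (Fin m) ℝ)
    (q v : (Fin s ⊕ Fin m) → ℝ) :
    Matrix (Fin s ⊕ Fin m) (Fin s ⊕ Fin m) ℝ :=
  fun i j =>
    fderiv ℝ (fun p : (Fin s ⊕ Fin m) → ℝ =>
      (Mblk muu mau maa (p ∘ Sum.inl) *ᵥ v) i) q (Pi.single j 1)

/-- The Coriolis force vector `C(q, q̇) q̇ = [J(q,q̇) − ½ J(q,q̇)ᵀ] q̇`. -/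
def Cvec {s m : ℕ} (muu : (Fin s → ℝ) → Matrix (Fin s) (Fin s) ℝ)
    (mau : (Fin s → ℝ) → Matrix (Fin m) (Fin s) ℝ)
    (maa : Matrix (Fin m) (Fin m) ℝ)
    (q v : (Fin s ⊕ Fin m) → ℝ) : (Fin s ⊕ Fin m) → ℝ :=
  (Jmat muu mau maa q v - (1/2 : ℝ) • (Jmat muu mau maa q v)ᵀ) *ᵥ v

/-- The Schur complement `m_uu^s(q_u) = m_uu − m_auᵀ m_aa⁻¹ m_au`. -/
def muuS {s m : ℕ} (muu : (Fin s → ℝ) → Matrix (Fin s) (Fin s) ℝ)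
    (mau : (Fin s → ℝ) → Matrix (Fin m) (Fin s) ℝ)
    (maa : Matrix (Fin m) (Fin m) ℝ) (qu : Fin s → ℝ) : Matrix (Fin s) (Fin s) ℝ :=
  muu qu - (mau qu)ᵀ * maa⁻¹ * mau qu

/-- `M_a(q_u) = [[m_auᵀ m_aa⁻¹ m_au, m_auᵀ], [m_au, m_aa]]`. -/
def MaMat {s m : ℕ} (mau : (Fin s → ℝ) → Matrix (Fin m) (Fin s) ℝ)
    (maa : Matrix (Fin m) (Fin m) ℝ) (qu : Fin s → ℝ) :
    Matrix (Fin s ⊕ Fin m) (Fin s ⊕ Fin m) ℝ :=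
  Matrix.fromBlocks ((mau qu)ᵀ * maa⁻¹ * mau qu) (mau qu)ᵀ (mau qu) maa

/-- Storage function `H_u(q_u, q̇_u) = ½ q̇_uᵀ m_uu^s(q_u) q̇_u + V_u(q_u)`. -/
def Hu {s m : ℕ} (muu : (Fin s → ℝ) → Matrix (Fin s) (Fin s) ℝ)
    (mau : (Fin s → ℝ) → Matrix (Fin m) (Fin s) ℝ)
    (maa : Matrix (Fin m) (Fin m) ℝ) (Vu : (Fin s → ℝ) → ℝ)
    (qu vu : Fin s → ℝ) : ℝ :=
  (1/2 : ℝ) * (vu ⬝ᵥ muuS muu mau maa qu *ᵥ vu) + Vu qu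

/-- Storage function `H_a(q_u, q̇) = ½ q̇ᵀ M_a(q_u) q̇`. -/
def Ha {s m : ℕ} (mau : (Fin s → ℝ) → Matrix (Fin m) (Fin s) ℝ)
    (maa : Matrix (Fin m) (Fin m) ℝ) (qu : Fin s → ℝ)
    (qdot : (Fin s ⊕ Fin m) → ℝ) : ℝ :=
  (1/2 : ℝ) * (qdot ⬝ᵥ MaMat mau maa qu *ᵥ qdot)

/-- Passive output `y_u = −m_aa⁻¹ m_au(q_u) q̇_u`. -/
def yU {s m : ℕ} (mau : (Fin s → ℝ) → Matrix (Fin m) (Fin s) ℝ)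
    (maa : Matrix (Fin m) (Fin m) ℝ) (qu vu : Fin s → ℝ) : Fin m → ℝ :=
  -(maa⁻¹ *ᵥ (mau qu *ᵥ vu))

/-- Passive output `y_a = m_aa⁻¹ m_au(q_u) q̇_u + q̇_a`. -/
def yA {s m : ℕ} (mau : (Fin s → ℝ) → Matrix (Fin m) (Fin s) ℝ)
    (maa : Matrix (Fin m) (Fin m) ℝ) (qu vu : Fin s → ℝ) (va : Fin m → ℝ) : Fin m → ℝ :=
  maa⁻¹ *ᵥ (mau qu *ᵥ vu) + va

/-- If the entries of the inertia matrix are differentiable, the derivative of `q ↦ (M(q_u) v)ᵢ` at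
`q` in the direction `w` is `∑ⱼ vⱼ (D Mᵢⱼ)(q_u) w_u`. -/
theorem fderiv_Mblk_mulVec_apply {s m : ℕ} {muu : (Fin s → ℝ) → Matrix (Fin s) (Fin s) ℝ}
    {mau : (Fin s → ℝ) → Matrix (Fin m) (Fin s) ℝ} {maa : Matrix (Fin m) (Fin m) ℝ}
    (hmuu : ∀ i j, Differentiable ℝ fun x => muu x i j)
    (hmau : ∀ i j, Differentiable ℝ fun x => mau x i j)
    (q v w : (Fin s ⊕ Fin m) → ℝ) (i : Fin s ⊕ Fin m) :
    fderiv ℝ (fun p : (Fin s ⊕ Fin m) → ℝ => (Mblk muu mau maa (p ∘ Sum.inl) *ᵥ v) i) q w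
      = ∑ j, v j * fderiv ℝ (fun x => Mblk muu mau maa x i j) (q ∘ Sum.inl) (w ∘ Sum.inl) := by
  have hentry : ∀ j, Differentiable ℝ fun x => Mblk muu mau maa x i j := by
    intro j
    rcases i with i | i <;> rcases j with j | j <;> simp [Mblk, hmuu, hmau]
  let L : ((Fin s ⊕ Fin m) → ℝ) →L[ℝ] (Fin s → ℝ) :=
    ContinuousLinearMap.pi fun k => ContinuousLinearMap.proj (Sum.inl k)
  have hF : HasFDerivAt
      (fun p : (Fin s ⊕ Fin m) → ℝ => ∑ j, Mblk muu mau maa (p ∘ Sum.inl) i j * v j)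
      (∑ j, v j • (fderiv ℝ (fun x => Mblk muu mau maa x i j) (q ∘ Sum.inl)).comp L) q :=
    HasFDerivAt.fun_sum fun j _ =>
      (((hentry j (q ∘ Sum.inl)).hasFDerivAt).comp (f := L) q L.hasFDerivAt).mul_const (v j)
  have hL : L w = w ∘ Sum.inl := rfl
  change fderiv ℝ
    (fun p : (Fin s ⊕ Fin m) → ℝ => ∑ j, Mblk muu mau maa (p ∘ Sum.inl) i j * v j) q w = _
  rw [hF.fderiv]
  simp [hL]

/-- Since neither `m_au` nor `m_aa` depends on `q_a`, the actuated rows of the Coriolis force reduce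
to `(D m_au)(q_u)[q̇_u] q̇_u`. -/
theorem Cvec_inr {s m : ℕ} {muu : (Fin s → ℝ) → Matrix (Fin s) (Fin s) ℝ}
    {mau : (Fin s → ℝ) → Matrix (Fin m) (Fin s) ℝ} {maa : Matrix (Fin m) (Fin m) ℝ}
    (hmuu : ∀ i j, Differentiable ℝ fun x => muu x i j)
    (hmau : ∀ i j, Differentiable ℝ fun x => mau x i j)
    (q v : (Fin s ⊕ Fin m) → ℝ) (a : Fin m) :
    Cvec muu mau maa q v (Sum.inr a)
      = ∑ j, fderiv ℝ (fun x => mau x a j) (q ∘ Sum.inl) (v ∘ Sum.inl) * v (Sum.inl j) := by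
  have hrow : (Jmat muu mau maa q v *ᵥ v) (Sum.inr a)
      = ∑ j, fderiv ℝ (fun x => mau x a j) (q ∘ Sum.inl) (v ∘ Sum.inl) * v (Sum.inl j) := by
    have hsum : (Jmat muu mau maa q v *ᵥ v) (Sum.inr a) = fderiv ℝ
        (fun p : (Fin s ⊕ Fin m) → ℝ => (Mblk muu mau maa (p ∘ Sum.inl) *ᵥ v) (Sum.inr a)) q v := by
      conv_rhs => rw [pi_eq_sum_univ' v, map_sum]
      simp only [mulVec, dotProduct, Jmat, map_smul, smul_eq_mul]
      refine Finset.sum_congr rfl fun k _ => ?_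
      rw [mul_comm]
      congr 2
      ext l
      simp [Pi.single_apply]
    rw [hsum, fderiv_Mblk_mulVec_apply hmuu hmau]
    simp [Mblk, mul_comm]
  have hcol : ((Jmat muu mau maa q v)ᵀ *ᵥ v) (Sum.inr a) = 0 := by
    rw [mulVec, dotProduct]
    refine Finset.sum_eq_zero fun k _ => mul_eq_zero_of_left ?_ _
    have hsingle : (Pi.single (Sum.inr a) (1 : ℝ) : (Fin s ⊕ Fin m) → ℝ) ∘ Sum.inl = 0 := by
      ext l
      simp
    simp only [transpose_apply, Jmat]
    rw [fderiv_Mblk_mulVec_apply hmuu hmau, hsingle]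
    simp
  rw [Cvec, sub_mulVec, smul_mulVec, Pi.sub_apply, Pi.smul_apply, hrow, hcol, smul_zero, sub_zero]

/-- along any trajectory with inner-loop control `u = τ − ∇V_a(q_a)`, the
signal `y_d = k_a q̇_a + (k_a − k_u) m_aa⁻¹ m_au(q_u) q̇_u` satisfies
`ẏ_d = (k_a − k_u) m_aa⁻¹ u + k_u q̈_a`. -/
theorem yd_derivative_identity
    {s m : ℕ} (hs : 1 ≤ s) (hm : 1 ≤ m)
    (muu : (Fin s → ℝ) → Matrix (Fin s) (Fin s) ℝ)
    (mau : (Fin s → ℝ) → Matrix (Fin m) (Fin s) ℝ)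
    (maa : Matrix (Fin m) (Fin m) ℝ)
    (hmuu : ∀ i j, ContDiff ℝ (⊤ : ℕ∞) fun x => muu x i j)
    (hmau : ∀ i j, ContDiff ℝ (⊤ : ℕ∞) fun x => mau x i j)
    (hmaa : maa.IsSymm)
    (hM : ∀ qu, (Mblk muu mau maa qu).PosDef)
    (Vu : (Fin s → ℝ) → ℝ) (Va : (Fin m → ℝ) → ℝ)
    (hVu : ContDiff ℝ (⊤ : ℕ∞) Vu) (hVa : ContDiff ℝ (⊤ : ℕ∞) Va)
    (ke ka ku : ℝ) (hke : ke ≠ 0) (hka : ka ≠ 0) (hku : ku ≠ 0) (hkaku : ka ≠ ku)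
    (q qd qdd : ℝ → (Fin s ⊕ Fin m) → ℝ)
    (τ : ℝ → Fin m → ℝ) (hτ : ContinuousOn τ (Ici 0))
    (hq : ∀ t ∈ Ici (0:ℝ), HasDerivWithinAt q (qd t) (Ici 0) t)
    (hqd : ∀ t ∈ Ici (0:ℝ), HasDerivWithinAt qd (qdd t) (Ici 0) t)
    (hqdd : ContinuousOn qdd (Ici 0))
    (hEL : ∀ t ∈ Ici (0:ℝ),
      Mblk muu mau maa (q t ∘ Sum.inl) *ᵥ qdd t
        + Cvec muu mau maa (q t) (qd t)
        + Sum.elim (grad Vu (q t ∘ Sum.inl)) (grad Va (q t ∘ Sum.inr))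
      = Sum.elim (0 : Fin s → ℝ) (τ t))
 :
    ∀ t ∈ Ici (0:ℝ),
      HasDerivWithinAt
        (fun t => ka • (qd t ∘ Sum.inr)
          + (ka - ku) • ((maa⁻¹ * mau (q t ∘ Sum.inl)) *ᵥ (qd t ∘ Sum.inl)))
        ((ka - ku) • (maa⁻¹ *ᵥ (τ t - grad Va (q t ∘ Sum.inr))) + ku • (qdd t ∘ Sum.inr))
        (Ici 0) t := by
  have hmuu' : ∀ i j, Differentiable ℝ fun x => muu x i j := fun i j =>
    (hmuu i j).differentiable (by simp)
  have hmau' : ∀ i j, Differentiable ℝ fun x => mau x i j := fun i j =>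
    (hmau i j).differentiable (by simp)
  have hmaa_posDef : maa.PosDef := (hM 0).submatrix (e := Sum.inr) Sum.inr_injective
  have hdet : IsUnit maa.det := (isUnit_iff_isUnit_det _).mp hmaa_posDef.isUnit
  intro t ht
  have hqu : HasDerivWithinAt (fun t => q t ∘ Sum.inl) (qd t ∘ Sum.inl) (Ici 0) t :=
    hasDerivWithinAt_pi.mpr fun j => hasDerivWithinAt_pi.mp (hq t ht) (Sum.inl j)
  have hqdu : ∀ k, HasDerivWithinAt (fun t => qd t k) (qdd t k) (Ici 0) t :=
    hasDerivWithinAt_pi.mp (hqd t ht)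
  -- The actuated momentum `m_au q̇_u` has derivative `u - m_aa q̈_a` by the equations of motion.
  have hmom : HasDerivWithinAt (fun t => mau (q t ∘ Sum.inl) *ᵥ (qd t ∘ Sum.inl))
      (τ t - grad Va (q t ∘ Sum.inr) - maa *ᵥ (qdd t ∘ Sum.inr)) (Ici 0) t := by
    refine hasDerivWithinAt_pi.mpr fun a => ?_
    have hsum : HasDerivWithinAt
        (fun t => ∑ j, mau (q t ∘ Sum.inl) a j * qd t (Sum.inl j))
        (∑ j, (fderiv ℝ (fun x => mau x a j) (q t ∘ Sum.inl) (qd t ∘ Sum.inl) * qd t (Sum.inl j)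
          + mau (q t ∘ Sum.inl) a j * qdd t (Sum.inl j))) (Ici 0) t :=
      HasDerivWithinAt.fun_sum fun j _ =>
        (((hmau' a j (q t ∘ Sum.inl)).hasFDerivAt).comp_hasDerivWithinAt t hqu).mul
          (hqdu (Sum.inl j))
    refine hsum.congr_deriv ?_
    have hrow := congrFun (hEL t ht) (Sum.inr a)
    rw [Pi.add_apply, Pi.add_apply, Cvec_inr hmuu' hmau', Mblk, fromBlocks_mulVec] at hrow
    simp only [Sum.elim_inr, Pi.add_apply] at hrow
    rw [Finset.sum_add_distrib, Pi.sub_apply, Pi.sub_apply]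
    change (∑ j, mau (q t ∘ Sum.inl) a j * qdd t (Sum.inl j)) + _ + _ + _ = _ at hrow
    linarith
  have hinv : HasDerivWithinAt
      (fun t => (maa⁻¹ * mau (q t ∘ Sum.inl)) *ᵥ (qd t ∘ Sum.inl))
      (maa⁻¹ *ᵥ (τ t - grad Va (q t ∘ Sum.inr)) - qdd t ∘ Sum.inr) (Ici 0) t := by
    have h := (maa⁻¹.mulVecLin.toContinuousLinearMap).hasFDerivAt.comp_hasDerivWithinAt t hmom
    simpa [Function.comp_def, mulVec_sub, mulVec_mulVec, nonsing_inv_mul _ hdet] using h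
  have hqda : HasDerivWithinAt (fun t => qd t ∘ Sum.inr) (qdd t ∘ Sum.inr) (Ici 0) t :=
    hasDerivWithinAt_pi.mpr fun a => hqdu (Sum.inr a)
  refine ((hqda.const_smul ka).add (hinv.const_smul (ka - ku))).congr_deriv ?_
  module
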